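/- The type-I cubic spline interpolating given grid data is unique: if s and t are both functions of class C² on [0,1] whose restriction to each interval [x_j, x_{j+1}] (0 ≤ j ≤ N−1) coincides with a polynomial of degree at most 3, and both satisfy s(x_j) = t(x_j) = f_j for 0 ≤ j ≤ N and s(0) = s′(0) = s(1) = s′(1) = 0, t(0) = t′(0) = t(1) = t′(1) = 0, then s = t on [0,1]. -/

import Mathlib

open Set

/-- `IsSpline N f s`: `s` is a type-I cubic spline for the data `f` on the uniform grid
`x_j = j/N`: it is of class `C²`, coincides on each interval `[x_j, x_{j+1}]` with a
polynomial of degree at most 3, interpolates `s(x_j) = f j`, and satisfies the clamped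
boundary conditions `s(0) = s'(0) = s(1) = s'(1) = 0`. -/
def IsSpline (N : ℕ) (f : ℕ → ℝ) (s : ℝ → ℝ) : Prop :=
  ContDiff ℝ 2 s ∧
  (∀ j : ℕ, j < N → ∃ p : Polynomial ℝ, p.degree ≤ 3 ∧
      ∀ x ∈ Set.Icc ((j : ℝ) / N) (((j : ℝ) + 1) / N), s x = p.eval x) ∧
  (∀ j : ℕ, j ≤ N → s ((j : ℝ) / N) = f j) ∧
  s 0 = 0 ∧ deriv s 0 = 0 ∧ s 1 = 0 ∧ deriv s 1 = 0

theorem eqOn_deriv_of_eqOn_Icc {f g : ℝ → ℝ} {a b : ℝ} (hab : a < b)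
    (hf : Differentiable ℝ f) (hg : Differentiable ℝ g) (h : EqOn f g (Icc a b)) :
    EqOn (deriv f) (deriv g) (Icc a b) := by
  intro x hx
  have hu := uniqueDiffOn_Icc hab x hx
  rw [← (hf x).derivWithin hu, ← (hg x).derivWithin hu]
  exact derivWithin_congr h (h hx)

theorem eval_eq_of_degree_le_three {p : Polynomial ℝ} (hp : p.degree ≤ 3) (x : ℝ) :
    p.eval x = p.coeff 0 + p.coeff 1 * x + p.coeff 2 * x ^ 2 + p.coeff 3 * x ^ 3 := by
  have h : p.natDegree < 4 := Nat.lt_succ_of_le (Polynomial.natDegree_le_of_degree_le hp)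
  rw [Polynomial.eval_eq_sum_range' h]
  simp [Finset.sum_range_succ]

/-- For a cubic piece vanishing at both endpoints, the increment of the product of
the first two derivatives of `u` is a positive
definite quadratic form in the endpoint slopes, and the piece vanishes if both slopes do. -/
theorem cubic_piece {u : ℝ → ℝ} {a b : ℝ} (hab : a < b) (hu : ContDiff ℝ 2 u)
    {p : Polynomial ℝ} (hp : p.degree ≤ 3) (hup : ∀ x ∈ Icc a b, u x = p.eval x)
    (ha : u a = 0) (hb : u b = 0) :
    (b - a) * (deriv (deriv u) b * deriv u b - deriv (deriv u) a * deriv u a) =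
        4 * (deriv u a ^ 2 + deriv u a * deriv u b + deriv u b ^ 2) ∧
      (deriv u a = 0 → deriv u b = 0 → ∀ x ∈ Icc a b, u x = 0) := by
  have hu' : Differentiable ℝ (deriv u) :=
    (hu.iterate_deriv' 1 1).differentiable one_ne_zero
  have h1 := eqOn_deriv_of_eqOn_Icc hab (hu.differentiable two_ne_zero) p.differentiable hup
  have hd : deriv (fun x => p.eval x) = fun x => p.derivative.eval x := by
    funext x
    exact p.deriv
  have hd' : deriv (fun x => p.derivative.eval x) = fun x => p.derivative.derivative.eval x := by
    funext x
    exact p.derivative.deriv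
  rw [hd] at h1
  have h2 := eqOn_deriv_of_eqOn_Icc hab hu' p.derivative.differentiable h1
  rw [hd'] at h2
  have hp' : p.derivative.degree ≤ 3 := Polynomial.degree_derivative_le.trans hp
  have hp'' : p.derivative.derivative.degree ≤ 3 := Polynomial.degree_derivative_le.trans hp'
  have h4 : p.coeff 4 = 0 := Polynomial.coeff_eq_zero_of_degree_lt (hp.trans_lt (by norm_num))
  have h5 : p.coeff 5 = 0 := Polynomial.coeff_eq_zero_of_degree_lt (hp.trans_lt (by norm_num))
  simp only [eval_eq_of_degree_le_three hp] at hup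
  have hma : a ∈ Icc a b := left_mem_Icc.2 hab.le
  have hmb : b ∈ Icc a b := right_mem_Icc.2 hab.le
  have ea := hup a hma
  have eb := hup b hmb
  have ea1 := h1 hma
  have eb1 := h1 hmb
  have ea2 := h2 hma
  have eb2 := h2 hmb
  simp only [eval_eq_of_degree_le_three hp',
    eval_eq_of_degree_le_three hp'', Polynomial.coeff_derivative] at ea eb ea1 eb1 ea2 eb2
  norm_num [h4, h5] at ea eb ea1 eb1 ea2 eb2
  rw [ha] at ea
  rw [hb] at eb
  have hne : b - a ≠ 0 := (sub_pos.2 hab).ne'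
  generalize p.coeff 0 = c₀, p.coeff 1 = c₁, p.coeff 2 = c₂, p.coeff 3 = c₃ at *
  have hc₁ : c₁ = -(c₂ * (a + b) + c₃ * (a ^ 2 + a * b + b ^ 2)) := by
    apply mul_left_cancel₀ hne
    linear_combination ea - eb
  refine ⟨?_, fun hm hn x hx => ?_⟩
  · rw [ea1, eb1, ea2, eb2, hc₁]
    ring
  · rw [ea1, hc₁] at hm
    rw [eb1, hc₁] at hn
    have hc₃ : c₃ = 0 := by
      apply mul_left_cancel₀ (pow_ne_zero 2 hne)
      linear_combination hm + hn
    have hc₂ : c₂ = 0 := by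
      apply mul_left_cancel₀ hne
      subst hc₃
      linear_combination hn
    rw [hup x hx]
    rw [hc₁, hc₂, hc₃] at ea
    rw [hc₁, hc₂, hc₃]
    linear_combination -ea

/-- Uniqueness of the type-I cubic spline interpolating given grid data: two such splines
agree on `[0,1]`. -/
theorem spline_unique
    (N : ℕ) (hN : 2 ≤ N) (f : ℕ → ℝ) (hf0 : f 0 = 0) (hfN : f N = 0)
    (s t : ℝ → ℝ) (hs : IsSpline N f s) (ht : IsSpline N f t) :
    Set.EqOn s t (Set.Icc 0 1) := by
  have hN0 : (0 : ℝ) < N := by exact_mod_cast (by omega : 0 < N)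
  obtain ⟨hs2, hsp, hsi, -, hs0, -, hs1⟩ := hs
  obtain ⟨ht2, htp, hti, -, ht0, -, ht1⟩ := ht
  set u : ℝ → ℝ := s - t with hu
  have hu2 : ContDiff ℝ 2 u := hs2.sub ht2
  have hdu : ∀ x, deriv u x = deriv s x - deriv t x := fun x =>
    deriv_sub (hs2.differentiable two_ne_zero x) (ht2.differentiable two_ne_zero x)
  have huz : ∀ j : ℕ, j ≤ N → u ((j : ℝ) / N) = 0 := fun j hj => by
    simp [hu, hsi j hj, hti j hj]
  have hlt : ∀ j : ℕ, (j : ℝ) / N < ((j : ℝ) + 1) / N := fun j => by gcongr; linarith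
  have piece : ∀ j : ℕ, j < N → _ ∧ _ := fun j hj => by
    obtain ⟨p, hp, hsp⟩ := hsp j hj
    obtain ⟨q, hq, htq⟩ := htp j hj
    exact cubic_piece (hlt j) hu2 (p := p - q)
      ((Polynomial.degree_sub_le p q).trans (max_le hp hq))
      (fun x hx => by simp [hu, hsp x hx, htq x hx])
      (huz j hj.le) (by exact_mod_cast huz (j + 1) hj)
  set E : ℕ → ℝ := fun j => deriv (deriv u) ((j : ℝ) / N) * deriv u ((j : ℝ) / N) with hE
  have hE0 : E 0 = 0 := by simp [hE, hdu, hs0, ht0]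
  have hEN : E N = 0 := by simp [hE, hdu, hN0.ne', hs1, ht1]
  have hstep : ∀ j, j < N → E j ≤ E (j + 1) := fun j hj => by
    have h := (piece j hj).1
    simp only [hE, Nat.cast_add, Nat.cast_one]
    refine sub_nonneg.1 (nonneg_of_mul_nonneg_right (h.symm ▸ ?_) (sub_pos.2 (hlt j)))
    nlinarith [sq_nonneg (deriv u (j / N) + deriv u ((j + 1) / N)),
      sq_nonneg (deriv u (j / N)), sq_nonneg (deriv u ((j + 1) / N))]
  have hnonneg : ∀ j, j ≤ N → 0 ≤ E j := fun j => by
    induction j with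
    | zero => exact fun _ => hE0.ge
    | succ j ih => exact fun hj => (ih (by omega)).trans (hstep j hj)
  have hnonpos : ∀ j, j ≤ N → E j ≤ 0 := fun j hj =>
    Nat.decreasingInduction' (P := fun j => E j ≤ 0)
      (fun k hk _ ih => (hstep k hk).trans ih) hj hEN.le
  have hEz : ∀ j, j ≤ N → E j = 0 := fun j hj => le_antisymm (hnonpos j hj) (hnonneg j hj)
  have hzero : ∀ j : ℕ, j < N → ∀ x ∈ Icc ((j : ℝ) / N) (((j : ℝ) + 1) / N), u x = 0 := by
    intro j hj
    obtain ⟨h, hvan⟩ := piece j hj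
    have e0 := hEz j hj.le
    have e1 := hEz (j + 1) hj
    simp only [hE, Nat.cast_add, Nat.cast_one] at e0 e1
    rw [e0, e1, sub_zero, mul_zero] at h
    generalize deriv u (j / N) = m, deriv u ((j + 1) / N) = n at h hvan
    have hm : m ^ 2 = 0 := by nlinarith [sq_nonneg (m + n), sq_nonneg m, sq_nonneg n]
    have hn : n ^ 2 = 0 := by nlinarith [sq_nonneg (m + n), sq_nonneg m, sq_nonneg n]
    exact hvan (pow_eq_zero_iff two_ne_zero |>.1 hm) (pow_eq_zero_iff two_ne_zero |>.1 hn)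
  intro x hx
  suffices h : u x = 0 from sub_eq_zero.1 h
  rcases hx.2.eq_or_lt with rfl | hx1
  · simpa [hN0.ne'] using huz N le_rfl
  · have hxN : 0 ≤ x * N := mul_nonneg hx.1 hN0.le
    refine hzero ⌊x * N⌋₊ ((Nat.floor_lt hxN).2 (by nlinarith)) x ⟨?_, ?_⟩
    · rw [div_le_iff₀ hN0]
      exact Nat.floor_le hxN
    · rw [le_div_iff₀ hN0]
      exact (Nat.lt_floor_add_one _).le
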